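/- Let n ≥ 3, j ∈ {2,…,n-1}, p ∈ [0,1), and λ ∈ (0,1). Then there exist origin-symmetric convex bodies K and L in ℝⁿ such that V_j((1-λ)·K +_p λ·L) < V_j(K)^{1-λ}·V_j(L)^λ ≤ ((1-λ)V_j(K)^{p/j} + λV_j(L)^{p/j})^{j/p}. -/

import Mathlib

open MeasureTheory Metric Matrix
open scoped RealInnerProductSpace Pointwise

noncomputable section

abbrev Euc (n : ℕ) := EuclideanSpace ℝ (Fin n)

/-- The support function of a set `K ⊆ ℝⁿ`. -/
def suppFn {n : ℕ} (K : Set (Euc n)) (x : Euc n) : ℝ :=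
  sSup ((fun y => ⟪x, y⟫) '' K)

/-- `κ_d`, the volume of the `d`-dimensional Euclidean unit ball. -/
def kappa (d : ℕ) : ℝ := (volume (ball (0 : Euc d) 1)).toReal

/-- The `(n-1)`-dimensional Hausdorff measure on the unit sphere. -/
def sphM (n : ℕ) : Measure (Euc n) := (μH[(n : ℝ) - 1]).restrict (sphere (0 : Euc n) 1)

/-- The Wulff shape of `f`: the largest convex body whose support function is dominated by `f`. -/
def wulff {n : ℕ} (f : Euc n → ℝ) : Set (Euc n) :=
  {x | ∀ u : Euc n, ‖u‖ = 1 → ⟪x, u⟫ ≤ f u}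

/-- The `p`-combination `((1-λ)a^p + λb^p)^{1/p}` (geometric mean for `p = 0`). -/
def combP (p lam a b : ℝ) : ℝ :=
  if p = 0 then a ^ (1 - lam) * b ^ lam
  else ((1 - lam) * a ^ p + lam * b ^ p) ^ (1 / p)

/-- The Hessian matrix (in the standard coordinates of `ℝⁿ`) of `h : ℝⁿ → ℝ` at `u`. -/
def hessMat {n : ℕ} (h : Euc n → ℝ) (u : Euc n) : Matrix (Fin n) (Fin n) ℝ :=
  Matrix.of fun i k =>
    fderiv ℝ (fun x => fderiv ℝ h x (EuclideanSpace.single k 1)) u (EuclideanSpace.single i 1)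

/-- `s_j`: the normalized `j`-th elementary symmetric function of the principal radii of
curvature (for a 1-homogeneous `h`, the `j`-th elementary symmetric function of the eigenvalues
of the full Hessian at `u`, read off the characteristic polynomial). -/
def sjFun (n j : ℕ) (h : Euc n → ℝ) (u : Euc n) : ℝ :=
  (((n - 1).choose j : ℝ))⁻¹ * ((-1 : ℝ) ^ j * ((hessMat h u).charpoly.coeff (n - j)))

/-- A function `V : ℕ → Set ℝⁿ → ℝ` realizes the intrinsic volumes via the Steiner formula. -/
def steiner (n : ℕ) (V : ℕ → Set (Euc n) → ℝ) : Prop :=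
  ∀ K : Set (Euc n), IsCompact K → Convex ℝ K → K.Nonempty → ∀ ρ : ℝ, 0 < ρ →
    (volume (K + closedBall (0 : Euc n) ρ)).toReal
      = ∑ i ∈ Finset.range (n + 1), ρ ^ (n - i) * kappa (n - i) * V i K

/-! ### Boxes and their parallel bodies -/

/-- The coordinate box with half side lengths `s`. -/
def boxS {n : ℕ} (s : Fin n → ℝ) : Set (Euc n) := {x | ∀ i, |x i| ≤ s i}

/-- Soft thresholding. -/
def soft (s x : ℝ) : ℝ := max (x - s) 0 + min (x + s) 0

lemma soft_measurable (s : ℝ) : Measurable (soft s) := by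
  unfold soft; fun_prop

lemma soft_vol (s : ℝ) (hs : 0 ≤ s) (A : Set ℝ) (hA : MeasurableSet A) :
    volume (soft s ⁻¹' A) = volume A + (2 * s).toNNReal • Measure.dirac (0 : ℝ) A := by
  have e1 : soft s ⁻¹' A ∩ Set.Ioi s = (fun x => x + (-s)) ⁻¹' (A ∩ Set.Ioi 0) := by
    ext x
    simp only [Set.mem_inter_iff, Set.mem_preimage, Set.mem_Ioi]
    have : s < x → soft s x = x + -s := fun h => by
      unfold soft; rw [max_eq_left (by linarith), min_eq_right (by linarith)]; ring
    constructor
    · rintro ⟨h1, h2⟩; rw [this h2] at h1; exact ⟨h1, by linarith⟩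
    · rintro ⟨h1, h2⟩; have h3 : s < x := by linarith
      rw [this h3]; exact ⟨h1, h3⟩
  have e2 : soft s ⁻¹' A ∩ Set.Iio (-s) = (fun x => x + s) ⁻¹' (A ∩ Set.Iio 0) := by
    ext x
    simp only [Set.mem_inter_iff, Set.mem_preimage, Set.mem_Iio]
    have : x < -s → soft s x = x + s := fun h => by
      unfold soft; rw [max_eq_right (by linarith), min_eq_left (by linarith)]; ring
    constructor
    · rintro ⟨h1, h2⟩; rw [this h2] at h1; exact ⟨h1, by linarith⟩
    · rintro ⟨h1, h2⟩; have h3 : x < -s := by linarith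
      rw [this h3]; exact ⟨h1, h3⟩
  have e3 : volume (soft s ⁻¹' A ∩ Set.Icc (-s) s)
      = (2 * s).toNNReal • Measure.dirac (0 : ℝ) A := by
    have h0 : ∀ x ∈ Set.Icc (-s) s, soft s x = 0 := fun x hx => by
      unfold soft; rw [max_eq_right (by linarith [hx.2]), min_eq_right (by linarith [hx.1])]; ring
    by_cases h : (0 : ℝ) ∈ A
    · have : soft s ⁻¹' A ∩ Set.Icc (-s) s = Set.Icc (-s) s := by
        apply Set.inter_eq_right.2
        intro x hx; simp only [Set.mem_preimage]; rw [h0 x hx]; exact h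
      rw [this, Real.volume_Icc, Measure.dirac_apply' _ hA, Set.indicator_of_mem h]
      simp [ENNReal.smul_def, ENNReal.ofReal, two_mul]
    · have : soft s ⁻¹' A ∩ Set.Icc (-s) s = ∅ := by
        ext x
        simp only [Set.mem_inter_iff, Set.mem_preimage, Set.mem_empty_iff_false, iff_false]
        rintro ⟨h1, h2⟩; rw [h0 x h2] at h1; exact h h1
      rw [this, Measure.dirac_apply' _ hA, Set.indicator_of_notMem h]
      simp
  have hm := soft_measurable s hA
  have d1 : volume (soft s ⁻¹' A) = volume (soft s ⁻¹' A ∩ Set.Ioi s)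
      + (volume (soft s ⁻¹' A ∩ Set.Iio (-s)) + volume (soft s ⁻¹' A ∩ Set.Icc (-s) s)) := by
    rw [← measure_inter_add_sdiff (soft s ⁻¹' A) (measurableSet_Ioi (a := s))]
    congr 1
    rw [← measure_inter_add_sdiff (soft s ⁻¹' A \ Set.Ioi s) (measurableSet_Iio (a := -s))]
    congr 2
    · ext x; simp only [Set.mem_inter_iff, Set.mem_sdiff, Set.mem_Ioi, Set.mem_Iio]
      constructor
      · tauto
      · rintro ⟨h1, h2⟩; exact ⟨⟨h1, by linarith⟩, h2⟩
    · ext x; simp only [Set.mem_inter_iff, Set.mem_sdiff, Set.mem_Ioi, Set.mem_Iio, Set.mem_Icc,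
        not_lt]; tauto
  have d2 : volume A = volume (A ∩ Set.Ioi 0) + volume (A ∩ Set.Iio 0) := by
    rw [← measure_inter_add_sdiff A (measurableSet_Ioi (a := (0 : ℝ)))]
    congr 1
    rw [← measure_inter_add_sdiff (A \ Set.Ioi 0) (measurableSet_Iio (a := (0 : ℝ)))]
    have : volume ((A \ Set.Ioi 0) \ Set.Iio (0 : ℝ)) = 0 := by
      refine measure_mono_null (t := {0}) ?_ (by simp)
      intro x; simp only [Set.mem_sdiff, Set.mem_Ioi, Set.mem_Iio, not_lt, Set.mem_singleton_iff]
      rintro ⟨⟨_, h1⟩, h2⟩; linarith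
    rw [this, add_zero]
    congr 1
    ext x; simp only [Set.mem_inter_iff, Set.mem_sdiff, Set.mem_Ioi, Set.mem_Iio]
    constructor
    · tauto
    · rintro ⟨h1, h2⟩; exact ⟨⟨h1, by linarith⟩, h2⟩
  rw [d1, e1, e2, e3, d2, measure_preimage_add_right, measure_preimage_add_right, add_assoc]

/-- Mixed Dirac / Lebesgue factors. -/
def ms {n : ℕ} (S : Finset (Fin n)) (i : Fin n) : Measure ℝ :=
  if i ∈ S then Measure.dirac 0 else volume

instance {n : ℕ} (S : Finset (Fin n)) (i : Fin n) : SigmaFinite (ms S i) := by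
  unfold ms; split_ifs <;> infer_instance

lemma map_soft {n : ℕ} (s : Fin n → ℝ) (hs : ∀ i, 0 ≤ s i) :
    Measure.map (fun (x : Fin n → ℝ) i => soft (s i) (x i)) volume
      = ∑ S : Finset (Fin n), (∏ i ∈ S, (2 * s i).toNNReal) • Measure.pi (ms S) := by
  have hmeas : Measurable (fun (x : Fin n → ℝ) i => soft (s i) (x i)) := by
    refine measurable_pi_lambda _ fun i => (soft_measurable _).comp (measurable_pi_apply i)
  trans Measure.pi (fun i => (volume : Measure ℝ) + (2 * s i).toNNReal • Measure.dirac (0 : ℝ))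
  · symm
    apply Measure.pi_eq
    intro A hA
    rw [Measure.map_apply hmeas (MeasurableSet.univ_pi hA)]
    have : (fun (x : Fin n → ℝ) i => soft (s i) (x i)) ⁻¹' (Set.univ.pi A)
        = Set.univ.pi fun i => soft (s i) ⁻¹' (A i) := by
      ext x; simp
    rw [this, volume_pi, Measure.pi_pi]
    refine Finset.prod_congr rfl fun i _ => ?_
    rw [soft_vol _ (hs i) _ (hA i)]; rfl
  · apply Measure.pi_eq
    intro A hA
    have : ∀ i, ((volume : Measure ℝ) + (2 * s i).toNNReal • Measure.dirac (0 : ℝ)) (A i)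
      = ((2 * s i).toNNReal : ENNReal) * Measure.dirac (0 : ℝ) (A i) + volume (A i) := by
      intro i; rw [add_comm]; rfl
    simp_rw [this]
    rw [Finset.prod_add, Measure.finsetSum_apply, Finset.powerset_univ]
    refine Finset.sum_congr rfl fun S _ => ?_
    rw [Measure.smul_apply, Measure.pi_pi, ENNReal.smul_def, smul_eq_mul, Finset.prod_mul_distrib,
      mul_assoc]
    push_cast
    congr 1
    rw [← Finset.prod_mul_prod_compl S, Finset.compl_eq_univ_sdiff]
    congr 1
    · exact Finset.prod_congr rfl fun i hi => by simp [ms, hi]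
    · exact Finset.prod_congr rfl fun i hi => by
        rw [Finset.mem_sdiff] at hi; simp [ms, hi.2]

/-- The ball of radius `r` in coordinates. -/
def cball (n : ℕ) (r : ℝ) : Set (Fin n → ℝ) := {y | ∑ i, y i ^ 2 ≤ r ^ 2}

lemma cball_meas (n : ℕ) (r : ℝ) : MeasurableSet (cball n r) := by
  unfold cball
  exact measurableSet_le (by fun_prop) (by fun_prop)

lemma ms_scale {n : ℕ} (S : Finset (Fin n)) (r : ℝ) (hr : 0 < r) :
    Measure.pi (ms S) (cball n r) = ENNReal.ofReal r ^ (n - S.card) * Measure.pi (ms S) (cball n 1) := by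
  have key : Measure.pi (ms S)
      = (r.toNNReal ^ (n - S.card)) • Measure.map (fun (x : Fin n → ℝ) i => r * x i)
          (Measure.pi (ms S)) := by
    apply Measure.pi_eq
    intro A hA
    have hmeas : Measurable (fun (x : Fin n → ℝ) i => r * x i) := by fun_prop
    rw [Measure.smul_apply, Measure.map_apply hmeas (MeasurableSet.univ_pi hA)]
    have : (fun (x : Fin n → ℝ) i => r * x i) ⁻¹' (Set.univ.pi A)
        = Set.univ.pi fun i => (fun x => r * x) ⁻¹' (A i) := by
      ext x; simp
    rw [this, Measure.pi_pi]
    rw [← Finset.prod_mul_prod_compl S, ← Finset.prod_mul_prod_compl S, ENNReal.smul_def,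
      smul_eq_mul]
    have h1 : ∏ i ∈ S, ms S i ((fun x => r * x) ⁻¹' (A i)) = ∏ i ∈ S, ms S i (A i) := by
      refine Finset.prod_congr rfl fun i hi => ?_
      simp only [ms, hi, if_true]
      rw [Measure.dirac_apply' _ (hA i),
        Measure.dirac_apply' _ ((measurable_const_mul r) (hA i))]
      have h0 : (0 : ℝ) ∈ (fun x => r * x) ⁻¹' (A i) ↔ (0 : ℝ) ∈ A i := by
        rw [Set.mem_preimage, mul_zero]
      by_cases hm : (0 : ℝ) ∈ A i
      · rw [Set.indicator_of_mem hm, Set.indicator_of_mem (h0.2 hm)]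
      · rw [Set.indicator_of_notMem hm, Set.indicator_of_notMem (fun h => hm (h0.1 h))]
    have h2 : ∏ i ∈ Sᶜ, ms S i ((fun x => r * x) ⁻¹' (A i))
        = ENNReal.ofReal r⁻¹ ^ (n - S.card) * ∏ i ∈ Sᶜ, ms S i (A i) := by
      have hc : n - S.card = (Sᶜ).card := by rw [Finset.card_compl, Fintype.card_fin]
      rw [hc, ← Finset.prod_const, ← Finset.prod_mul_distrib]
      refine Finset.prod_congr rfl fun i hi => ?_
      rw [Finset.mem_compl] at hi
      simp only [ms, hi, if_false]
      rw [Real.volume_preimage_mul_left hr.ne', abs_of_pos (inv_pos.2 hr)]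
    rw [h1, h2]
    have h3 : ((r.toNNReal ^ (n - S.card) : NNReal) : ENNReal) * ENNReal.ofReal r⁻¹ ^ (n - S.card)
        = 1 := by
      push_cast
      rw [← mul_pow]
      have : (r.toNNReal : ENNReal) * ENNReal.ofReal r⁻¹ = 1 := by
        change ENNReal.ofReal r * _ = 1
        rw [← ENNReal.ofReal_mul hr.le, mul_inv_cancel₀ hr.ne']; simp
      rw [this, one_pow]
    calc _ = (((r.toNNReal ^ (n - S.card) : NNReal) : ENNReal)
              * ENNReal.ofReal r⁻¹ ^ (n - S.card)) * ((∏ i ∈ S, ms S i (A i))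
              * ∏ i ∈ Sᶜ, ms S i (A i)) := by ring
      _ = _ := by rw [h3, one_mul]
  have hmeas : Measurable (fun (x : Fin n → ℝ) i => r * x i) := by fun_prop
  conv_lhs => rw [key]
  rw [Measure.smul_apply, Measure.map_apply hmeas (cball_meas _ _), ENNReal.smul_def, smul_eq_mul]
  push_cast
  congr 2
  ext x
  simp only [cball, Set.mem_preimage, Set.mem_ofPred_eq, mul_pow, ← Finset.mul_sum]
  constructor
  · intro h; have := le_of_mul_le_mul_left (h.trans_eq (mul_one (r ^ 2)).symm) (pow_pos hr 2); simpa using this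
  · intro h; have := mul_le_mul_of_nonneg_left h (pow_pos hr 2).le; simpa using this

lemma ms_fin {n : ℕ} (S : Finset (Fin n)) : Measure.pi (ms S) (cball n 1) ≠ ⊤ := by
  have hsub : cball n 1 ⊆ Set.univ.pi fun _ => Set.Icc (-1) 1 := by
    intro x hx i _
    have h1 : x i ^ 2 ≤ ∑ i, x i ^ 2 :=
      Finset.single_le_sum (f := fun i => x i ^ 2) (fun _ _ => sq_nonneg _) (Finset.mem_univ i)
    have h2 : x i ^ 2 ≤ 1 := by
      have : ∑ i, x i ^ 2 ≤ (1 : ℝ) ^ 2 := hx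
      linarith
    exact abs_le.1 ((sq_le_one_iff_abs_le_one _).1 h2)
  refine ne_top_of_le_ne_top ?_ (measure_mono hsub)
  rw [Measure.pi_pi]
  refine ENNReal.prod_ne_top fun i _ => ?_
  unfold ms; split_ifs
  · exact measure_ne_top _ _
  · simp

lemma ms_pos {n : ℕ} (hn : 0 < n) (S : Finset (Fin n)) : Measure.pi (ms S) (cball n 1) ≠ 0 := by
  have hn' : (0 : ℝ) < n := by exact_mod_cast hn
  have hn1 : (1 : ℝ) ≤ n := by exact_mod_cast hn
  have hsub : (Set.univ.pi fun _ => Set.Icc (-(1 / n : ℝ)) (1 / n)) ⊆ cball n 1 := by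
    intro x hx
    have h1 : ∀ i, x i ^ 2 ≤ 1 / n := by
      intro i
      have h2 : |x i| ≤ 1 / n := abs_le.2 (hx i trivial)
      have h3 : (1 / n : ℝ) ≤ 1 := by rw [div_le_one hn']; exact hn1
      have h4 := abs_nonneg (x i)
      rw [← sq_abs]; nlinarith
    calc ∑ i, x i ^ 2 ≤ ∑ i : Fin n, (1 / n : ℝ) := Finset.sum_le_sum fun i _ => h1 i
      _ = 1 ^ 2 := by simp; field_simp
  intro h0
  have := measure_mono_null hsub h0
  rw [Measure.pi_pi, Finset.prod_eq_zero_iff] at this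
  obtain ⟨i, _, hi⟩ := this
  unfold ms at hi
  split_ifs at hi
  · rw [Measure.dirac_apply' _ measurableSet_Icc, Set.indicator_of_mem] at hi
    · simp at hi
    · constructor <;> [skip; skip] <;> simp
  · rw [Real.volume_Icc, ENNReal.ofReal_eq_zero] at hi
    have : 0 < 1 / (n : ℝ) := by positivity
    linarith

lemma soft_add (s x : ℝ) (hs : 0 ≤ s) : |x - soft s x| ≤ s := by
  unfold soft
  rw [abs_le]
  rcases max_cases (x - s) 0 with h | h <;> rcases min_cases (x + s) 0 with h' | h' <;>
    constructor <;> linarith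

lemma soft_le (s b y : ℝ) (hb : |b| ≤ s) : |soft s (b + y)| ≤ |y| := by
  unfold soft
  rw [abs_le] at hb
  rw [abs_le]
  rcases max_cases (b + y - s) 0 with h | h <;> rcases min_cases (b + y + s) 0 with h' | h' <;>
    rcases abs_cases y with h'' | h'' <;> constructor <;> linarith

lemma box_parallel {n : ℕ} (s : Fin n → ℝ) (hs : ∀ i, 0 ≤ s i) (r : ℝ) (hr : 0 < r) :
    boxS s + closedBall (0 : Euc n) r
      = (WithLp.ofLp : Euc n → (Fin n → ℝ)) ⁻¹'
        ((fun (x : Fin n → ℝ) i => soft (s i) (x i)) ⁻¹' cball n r) := by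
  ext x
  simp only [Set.mem_add, mem_closedBall, dist_zero_right, Set.mem_preimage, cball,
    Set.mem_ofPred_eq]
  have hnorm : ∀ y : Euc n, ‖y‖ ≤ r ↔ ∑ i, y i ^ 2 ≤ r ^ 2 := by
    intro y
    rw [← EuclideanSpace.real_norm_sq_eq, pow_le_pow_iff_left₀ (norm_nonneg _) hr.le two_ne_zero]
  constructor
  · rintro ⟨b, hb, y, hy, rfl⟩
    refine le_trans (Finset.sum_le_sum fun i _ => ?_) ((hnorm y).1 hy)
    exact sq_le_sq.2 (soft_le _ _ _ (hb i))
  · intro h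
    refine ⟨WithLp.toLp 2 fun i => x i - soft (s i) (x i), fun i => soft_add _ _ (hs i),
      WithLp.toLp 2 fun i => soft (s i) (x i), (hnorm _).2 h, ?_⟩
    ext i; simp

/-- The coefficients in the Steiner polynomial of boxes. -/
def mS {n : ℕ} (S : Finset (Fin n)) : ℝ := (Measure.pi (ms S) (cball n 1)).toReal

lemma mS_pos {n : ℕ} (hn : 0 < n) (S : Finset (Fin n)) : 0 < mS S :=
  ENNReal.toReal_pos (ms_pos hn S) (ms_fin S)

lemma box_vol {n : ℕ} (s : Fin n → ℝ) (hs : ∀ i, 0 ≤ s i) (r : ℝ) (hr : 0 < r) :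
    (volume (boxS s + closedBall (0 : Euc n) r)).toReal
      = ∑ S : Finset (Fin n), (∏ i ∈ S, (2 * s i)) * (r ^ (n - S.card) * mS S) := by
  have hmeas : Measurable (fun (x : Fin n → ℝ) i => soft (s i) (x i)) := by
    refine measurable_pi_lambda _ fun i => (soft_measurable _).comp (measurable_pi_apply i)
  rw [box_parallel s hs r hr,
    (PiLp.volume_preserving_ofLp (Fin n)).measure_preimage
      (hmeas (cball_meas n r)).nullMeasurableSet,
    ← Measure.map_apply hmeas (cball_meas n r), map_soft s hs, Measure.finsetSum_apply,
    ENNReal.toReal_sum]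
  · refine Finset.sum_congr rfl fun S _ => ?_
    rw [Measure.smul_apply, ms_scale S r hr, ENNReal.smul_def, smul_eq_mul]
    simp only [ENNReal.toReal_mul, ENNReal.toReal_pow, ENNReal.toReal_ofReal hr.le, mS]
    congr 1
    simp only [ENNReal.coe_toReal, NNReal.coe_prod]
    exact Finset.prod_congr rfl fun i _ => Real.coe_toNNReal _ (by linarith [hs i])
  · intro S _
    rw [Measure.smul_apply, ms_scale S r hr, ENNReal.smul_def, smul_eq_mul]
    exact ENNReal.mul_ne_top ENNReal.coe_ne_top
      (ENNReal.mul_ne_top (ENNReal.pow_ne_top ENNReal.ofReal_ne_top) (ms_fin S))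

/-! ### Elementary properties of boxes -/

lemma box_convex {n : ℕ} (s : Fin n → ℝ) : Convex ℝ (boxS s) := by
  intro x hx y hy a b ha hb hab i
  have h1 := abs_le.1 (hx i)
  have h2 := abs_le.1 (hy i)
  simp only [PiLp.add_apply, PiLp.smul_apply, smul_eq_mul]
  rw [abs_le]
  have hb' : b = 1 - a := by linarith
  subst hb'
  constructor <;> nlinarith

lemma box_compact {n : ℕ} (s : Fin n → ℝ) : IsCompact (boxS s) := by
  have h : boxS s = (WithLp.toLp 2 : (Fin n → ℝ) → Euc n) ''
      (Set.univ.pi fun i => Set.Icc (-s i) (s i)) := by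
    ext x
    constructor
    · intro hx
      exact ⟨x.ofLp, fun i _ => abs_le.1 (hx i), rfl⟩
    · rintro ⟨y, hy, rfl⟩ i
      exact abs_le.2 (hy i trivial)
  rw [h]
  exact (isCompact_univ_pi fun i => isCompact_Icc).image (PiLp.continuous_toLp 2 _)

lemma box_interior {n : ℕ} (s : Fin n → ℝ) (hs : ∀ i, 0 < s i) : (interior (boxS s)).Nonempty := by
  refine ⟨0, mem_interior.2 ⟨{x | ∀ i, |x i| < s i}, fun x hx i => (hx i).le, ?_, ?_⟩⟩
  · simp only [Set.ofPred_forall]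
    refine isOpen_iInter_of_finite fun i => isOpen_lt (by fun_prop) continuous_const
  · intro i; simpa using hs i

lemma box_symm {n : ℕ} (s : Fin n → ℝ) : ∀ x ∈ boxS s, -x ∈ boxS s := by
  intro x hx i; simpa using hx i

lemma box_V {n : ℕ} (V : ℕ → Set (Euc n) → ℝ) (hV : steiner n V) (s : Fin n → ℝ)
    (hs : ∀ i, 0 ≤ s i) (j : ℕ) (hj : j ≤ n) :
    kappa (n - j) * V j (boxS s)
      = ∑ S : Finset (Fin n) with S.card = j, (∏ i ∈ S, (2 * s i)) * mS S := by
  have h0 : (boxS s).Nonempty := ⟨0, fun i => by simpa using hs i⟩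
  let P : Polynomial ℝ := ∑ i ∈ Finset.range (n + 1),
    Polynomial.monomial (n - i) (kappa (n - i) * V i (boxS s))
  let Q : Polynomial ℝ := ∑ S : Finset (Fin n),
    Polynomial.monomial (n - S.card) ((∏ i ∈ S, (2 * s i)) * mS S)
  have hPQ : P = Q := by
    apply Polynomial.eq_of_infinite_eval_eq
    refine (Set.Ioi_infinite (0 : ℝ)).mono fun r hr => ?_
    have e1 := hV (boxS s) (box_compact s) (box_convex s) h0 r hr
    rw [box_vol s hs r hr] at e1
    simp only [Set.mem_ofPred_eq, P, Q, Polynomial.eval_finsetSum, Polynomial.eval_monomial]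
    calc _ = ∑ i ∈ Finset.range (n + 1), r ^ (n - i) * kappa (n - i) * V i (boxS s) :=
          Finset.sum_congr rfl fun i _ => by ring
      _ = _ := by rw [← e1]; exact Finset.sum_congr rfl fun i _ => by ring
  have hc : P.coeff (n - j) = Q.coeff (n - j) := by rw [hPQ]
  simp only [P, Q, Polynomial.finsetSum_coeff, Polynomial.coeff_monomial] at hc
  rw [Finset.sum_eq_single j] at hc
  · rw [if_pos rfl] at hc
    rw [hc, Finset.sum_filter]
    refine Finset.sum_congr rfl fun S _ => ?_
    have : S.card ≤ n := by simpa using Finset.card_le_univ S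
    have : (n - S.card = n - j) ↔ (S.card = j) := by omega
    simp only [this]
  · intro i hi hij
    rw [Finset.mem_range] at hi
    rw [if_neg (by omega)]
  · intro h; exact absurd (Finset.mem_range.2 (by omega)) h

lemma box_supp {n : ℕ} (s : Fin n → ℝ) (hs : ∀ i, 0 ≤ s i) (u : Euc n) :
    suppFn (boxS s) u = ∑ i, s i * |u i| := by
  unfold suppFn
  apply IsGreatest.csSup_eq
  constructor
  · refine ⟨WithLp.toLp 2 fun i => if 0 ≤ u i then s i else - s i, ?_, ?_⟩
    · intro i
      simp only
      split_ifs <;> simp [abs_of_nonneg (hs i)]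
    · simp only [PiLp.inner_apply, RCLike.inner_apply, conj_trivial]
      refine Finset.sum_congr rfl fun i _ => ?_
      split_ifs with h
      · rw [abs_of_nonneg h]
      · rw [abs_of_neg (not_le.1 h)]; ring
  · rintro _ ⟨y, hy, rfl⟩
    simp only [PiLp.inner_apply, RCLike.inner_apply, conj_trivial]
    refine Finset.sum_le_sum fun i _ => ?_
    calc y i * u i ≤ |y i * u i| := le_abs_self _
      _ = |y i| * |u i| := abs_mul _ _
      _ ≤ _ := mul_le_mul_of_nonneg_right (hy i) (abs_nonneg _)

/-! ### The p-combination -/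

lemma rpow_am2 (w₁ w₂ z₁ z₂ : ℝ) (hw₁ : 0 ≤ w₁) (hw₂ : 0 ≤ w₂) (hz₁ : 0 ≤ z₁) (hz₂ : 0 ≤ z₂)
    (hw : w₁ + w₂ = 1) (q : ℝ) (hq : 1 ≤ q) :
    (w₁ * z₁ + w₂ * z₂) ^ q ≤ w₁ * z₁ ^ q + w₂ * z₂ ^ q := by
  have := (convexOn_rpow hq).2 (x := z₁) hz₁ (y := z₂) hz₂ hw₁ hw₂ hw
  simpa only [smul_eq_mul] using this

lemma combP_support (p lam : ℝ) (hp : p ∈ Set.Ico (0 : ℝ) 1) (hlam : lam ∈ Set.Ioo (0 : ℝ) 1)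
    (A B : ℝ) (hA : 0 < A) (hB : 0 < B) :
    ∃ w₁ w₂ : ℝ, combP p lam A B = w₁ * A + w₂ * B ∧
      ∀ x y, 0 ≤ x → 0 ≤ y → combP p lam x y ≤ w₁ * x + w₂ * y := by
  obtain ⟨hl0, hl1⟩ := hlam
  obtain ⟨hp0, hp1⟩ := hp
  have hl1' : 0 < 1 - lam := by linarith
  rcases eq_or_lt_of_le hp0 with rfl | hp0
  · set C := A ^ (1 - lam) * B ^ lam with hC
    have hCpos : 0 < C := by positivity
    refine ⟨C * (1 - lam) / A, C * lam / B, ?_, ?_⟩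
    · simp only [combP, if_true]; rw [← hC]; field_simp; ring
    · intro x y hx hy
      simp only [combP, if_true]
      have h := Real.geom_mean_le_arith_mean2_weighted hl1'.le hl0.le (div_nonneg hx hA.le)
        (div_nonneg hy hB.le) (by ring)
      rw [Real.div_rpow hx hA.le, Real.div_rpow hy hB.le] at h
      have h2 := mul_le_mul_of_nonneg_left h hCpos.le
      calc x ^ (1 - lam) * y ^ lam
          = C * (x ^ (1 - lam) / A ^ (1 - lam) * (y ^ lam / B ^ lam)) := by
            rw [hC]; field_simp
        _ ≤ _ := h2
        _ = _ := by ring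
  · have hpne : p ≠ 0 := hp0.ne'
    set Z := (1 - lam) * A ^ p + lam * B ^ p with hZ
    have hAp : 0 < A ^ p := by positivity
    have hBp : 0 < B ^ p := by positivity
    have hZpos : 0 < Z := by positivity
    set C := Z ^ (1 / p) with hC
    have hCpos : 0 < C := by positivity
    set t := (1 - lam) * A ^ p / Z with ht
    set t' := lam * B ^ p / Z with ht'
    have htt : t + t' = 1 := by
      rw [ht, ht', ← add_div, ← hZ]; exact div_self hZpos.ne'
    have ht0 : 0 ≤ t := by positivity
    have ht0' : 0 ≤ t' := by positivity
    refine ⟨C * t / A, C * t' / B, ?_, ?_⟩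
    · simp only [combP, if_neg hpne]; rw [← hZ, ← hC]
      field_simp; rw [htt]
    · intro x y hx hy
      simp only [combP, if_neg hpne]
      have hxa : 0 ≤ (x / A) := div_nonneg hx hA.le
      have hyb : 0 ≤ (y / B) := div_nonneg hy hB.le
      have h := rpow_am2 t t' ((x / A) ^ p) ((y / B) ^ p) ht0 ht0'
        (by positivity) (by positivity) htt (1 / p)
        (by rw [le_div_iff₀ hp0]; linarith)
      rw [← Real.rpow_mul hxa, ← Real.rpow_mul hyb, mul_one_div_cancel hpne, Real.rpow_one,
        Real.rpow_one] at h
      have h2 := mul_le_mul_of_nonneg_left h hCpos.le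
      rw [hC, ← Real.mul_rpow hZpos.le (by positivity)] at h2
      have e : Z * (t * (x / A) ^ p + t' * (y / B) ^ p) = (1 - lam) * x ^ p + lam * y ^ p := by
        rw [Real.div_rpow hx hA.le, Real.div_rpow hy hB.le, ht, ht']
        field_simp
      rw [e] at h2
      refine h2.trans (le_of_eq ?_)
      rw [← hC]; ring

lemma combP_self (p lam a : ℝ) (ha : 0 < a) : combP p lam a a = a := by
  unfold combP
  split_ifs with h
  · rw [← Real.rpow_add ha]; simp
  · rw [← add_mul]; simp only [sub_add_cancel, one_mul]
    rw [← Real.rpow_mul ha.le, mul_one_div_cancel h, Real.rpow_one]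

lemma combP_nonneg (p lam a b : ℝ) (hlam : lam ∈ Set.Ioo (0 : ℝ) 1) (ha : 0 ≤ a) (hb : 0 ≤ b) :
    0 ≤ combP p lam a b := by
  obtain ⟨hl0, hl1⟩ := hlam
  have hl1' : 0 < 1 - lam := by linarith
  unfold combP
  split_ifs <;> positivity

lemma combP_lt (p lam e : ℝ) (hp : p ∈ Set.Ico (0 : ℝ) 1) (hlam : lam ∈ Set.Ioo (0 : ℝ) 1)
    (he : 0 < e) : combP p lam e (2 * e) = e * combP p lam 1 2 ∧ combP p lam 1 2 < 1 + lam := by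
  obtain ⟨hl0, hl1⟩ := hlam
  obtain ⟨hp0, hp1⟩ := hp
  have hl1' : 0 < 1 - lam := by linarith
  unfold combP
  split_ifs with h
  · constructor
    · rw [Real.mul_rpow (by norm_num) he.le, Real.one_rpow]
      calc _ = e ^ (1 - lam) * e ^ lam * 2 ^ lam := by ring
        _ = _ := by rw [← Real.rpow_add he]; simp
    · have := rpow_one_add_lt_one_add_mul_self (s := 1) (by norm_num) (by norm_num) hl0 hl1
      norm_num at this
      simpa using this
  · have hp0 : 0 < p := lt_of_le_of_ne hp0 (Ne.symm h)
    constructor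
    · rw [Real.mul_rpow (by norm_num) he.le, Real.one_rpow]
      have : (1 - lam) * e ^ p + lam * (2 ^ p * e ^ p) = e ^ p * ((1 - lam) * 1 + lam * 2 ^ p) := by
        ring
      rw [this, Real.mul_rpow (by positivity) (by positivity), ← Real.rpow_mul he.le,
        mul_one_div_cancel h, Real.rpow_one]
    · have hc := (Real.strictConcaveOn_rpow hp0 hp1).2 (x := 1) (by simp) (y := 2) (by simp)
        (by norm_num) hl1' hl0 (by ring)
      simp only [smul_eq_mul] at hc
      have e1 : (1 - lam) * 1 + lam * 2 = 1 + lam := by ring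
      rw [e1] at hc
      calc _ < ((1 + lam) ^ p) ^ (1 / p) :=
            Real.rpow_lt_rpow (by positivity) hc (by positivity)
        _ = 1 + lam := by
            rw [← Real.rpow_mul (by linarith), mul_one_div_cancel h, Real.rpow_one]

lemma final_ineq (lam M x : ℝ) (hlam : lam ∈ Set.Ioo (0 : ℝ) 1) (hM0 : 0 ≤ M) (hM : M < 1 + lam)
    (hx : x = (1 + lam - M) / 4) : 1 + x * M < (1 + x) ^ (1 - lam) * (1 + 2 * x) ^ lam := by
  obtain ⟨hl0, hl1⟩ := hlam
  have hl1' : 0 < 1 - lam := by linarith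
  have hx0 : 0 < x := by rw [hx]; linarith
  have h1 : 0 < 1 + x := by linarith
  have h2 : 0 < 1 + 2 * x := by linarith
  have h := Real.geom_mean_le_arith_mean2_weighted hl1'.le hl0.le (inv_pos.2 h1).le
    (inv_pos.2 h2).le (by ring)
  rw [Real.inv_rpow h1.le, Real.inv_rpow h2.le, ← mul_inv] at h
  set G := (1 + x) ^ (1 - lam) * (1 + 2 * x) ^ lam with hG
  have hG0 : 0 < G := by positivity
  have h3 : 1 ≤ ((1 - lam) * (1 + x)⁻¹ + lam * (1 + 2 * x)⁻¹) * G := by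
    have := mul_le_mul_of_nonneg_right h hG0.le
    rwa [inv_mul_cancel₀ hG0.ne'] at this
  have h4 : (1 + x) * (1 + 2 * x) ≤ (1 + (2 - lam) * x) * G := by
    have := mul_le_mul_of_nonneg_left h3 (mul_pos h1 h2).le
    calc _ = (1 + x) * (1 + 2 * x) * 1 := by ring
      _ ≤ _ := this
      _ = _ := by field_simp; ring
  have hD : 0 < 1 + (2 - lam) * x := by nlinarith
  have h5 : (1 + (2 - lam) * x) * (1 + x * M) < (1 + x) * (1 + 2 * x) := by
    have e : (1 + x) * (1 + 2 * x) - (1 + (2 - lam) * x) * (1 + x * M)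
        = x * ((1 + lam - M) + x * (2 - (2 - lam) * M)) := by ring
    have hb : (2 - lam) * M ≤ 4 := by nlinarith
    have : 0 < (1 + lam - M) + x * (2 - (2 - lam) * M) := by nlinarith
    nlinarith [mul_pos hx0 this]
  exact lt_of_mul_lt_mul_left (h5.trans_le h4) hD.le

lemma wulff_box {n : ℕ} (hn : 0 < n) (p lam : ℝ) (hp : p ∈ Set.Ico (0 : ℝ) 1)
    (hlam : lam ∈ Set.Ioo (0 : ℝ) 1) (a b : Fin n → ℝ) (ha : ∀ i, 0 < a i) (hb : ∀ i, 0 < b i) :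
    wulff (fun u => combP p lam (suppFn (boxS a) u) (suppFn (boxS b) u))
      = boxS fun i => combP p lam (a i) (b i) := by
  ext x
  constructor
  · intro hx i
    have h1 := hx (EuclideanSpace.single i 1) (by simp)
    have h2 := hx (EuclideanSpace.single i (-1)) (by simp)
    simp only [box_supp a fun i => (ha i).le, box_supp b fun i => (hb i).le] at h1 h2
    have e : ∀ (s : Fin n → ℝ) (c : ℝ), ∑ k, s k * |(EuclideanSpace.single i c : Euc n) k|
        = s i * |c| := by
      intro s c
      rw [Finset.sum_eq_single i]
      · simp
      · intro k _ hk; simp [hk]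
      · simp
    rw [e, e] at h1 h2
    simp [EuclideanSpace.inner_single_right] at h1 h2
    exact abs_le.2 ⟨by linarith, h1⟩
  · intro hx u hu
    simp only [box_supp a fun i => (ha i).le, box_supp b fun i => (hb i).le]
    have hpos : ∀ s : Fin n → ℝ, (∀ i, 0 < s i) → 0 < ∑ i, s i * |u i| := by
      intro s hs
      have hne : ∃ i, u i ≠ 0 := by
        by_contra hcon
        push Not at hcon
        have : u = 0 := by ext i; exact hcon i
        rw [this] at hu; simp at hu
      obtain ⟨i, hi⟩ := hne
      exact Finset.sum_pos' (fun k _ => mul_nonneg (hs k).le (abs_nonneg _))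
        ⟨i, Finset.mem_univ i, mul_pos (hs i) (abs_pos.2 hi)⟩
    obtain ⟨w₁, w₂, he, hw⟩ := combP_support p lam hp hlam _ _ (hpos a ha) (hpos b hb)
    rw [he]
    simp only [PiLp.inner_apply, RCLike.inner_apply, conj_trivial, Finset.mul_sum]
    rw [← Finset.sum_add_distrib]
    refine Finset.sum_le_sum fun i _ => ?_
    have h3 := hw (a i) (b i) (ha i).le (hb i).le
    calc u i * x i ≤ |u i * x i| := le_abs_self _
      _ = |x i| * |u i| := by rw [abs_mul, mul_comm]
      _ ≤ (w₁ * a i + w₂ * b i) * |u i| :=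
        mul_le_mul_of_nonneg_right ((hx i).trans h3) (abs_nonneg _)
      _ = _ := by ring

/-- Side lengths: `t` in direction `i₀`, `1` in the others. -/
def sideS {n : ℕ} (i₀ : Fin n) (t : ℝ) : Fin n → ℝ := Function.update (fun _ => 1) i₀ t

lemma sideS_pos {n : ℕ} (i₀ : Fin n) (t : ℝ) (ht : 0 < t) (i : Fin n) : 0 < sideS i₀ t i := by
  unfold sideS
  by_cases h : i = i₀
  · subst h; simpa using ht
  · simp [h]

lemma kappa_pos (d : ℕ) : 0 < kappa d :=
  ENNReal.toReal_pos (measure_ball_pos _ _ one_pos).ne' measure_ball_lt_top.ne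

lemma V_affine {n j : ℕ} (hj : 1 ≤ j) (hjn : j + 1 ≤ n) (i₀ : Fin n)
    (V : ℕ → Set (Euc n) → ℝ) (hV : steiner n V) :
    ∃ A B : ℝ, 0 < A ∧ 0 < B ∧ ∀ t, 0 < t → V j (boxS (sideS i₀ t)) = A + B * t := by
  have hk := kappa_pos (n - j)
  have hn : 0 < n := by omega
  let F : Finset (Finset (Fin n)) := {S | S.card = j}
  refine ⟨(∑ S ∈ F with i₀ ∉ S, 2 ^ j * mS S) / kappa (n - j),
    (∑ S ∈ F with i₀ ∈ S, 2 ^ j * mS S) / kappa (n - j), ?_, ?_, ?_⟩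
  · refine div_pos (Finset.sum_pos (fun S _ => mul_pos (by positivity) (mS_pos hn S)) ?_) hk
    obtain ⟨S, hS, hc⟩ := Finset.exists_subset_card_eq (s := ({i₀}ᶜ : Finset (Fin n))) (n := j)
      (by rw [Finset.card_compl]; simp; omega)
    have hi : i₀ ∉ S := fun h => by simpa using hS h
    exact ⟨S, by simp only [F, Finset.mem_filter, Finset.mem_univ, true_and]; exact ⟨hc, hi⟩⟩
  · refine div_pos (Finset.sum_pos (fun S _ => mul_pos (by positivity) (mS_pos hn S)) ?_) hk
    obtain ⟨S, hS, _, hc⟩ := Finset.exists_subsuperset_card_eq (s := ({i₀} : Finset (Fin n)))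
      (t := Finset.univ) (n := j) (Finset.subset_univ _) (by simpa using hj) (by simp; omega)
    have hi : i₀ ∈ S := hS (by simp)
    exact ⟨S, by simp only [F, Finset.mem_filter, Finset.mem_univ, true_and]; exact ⟨hc, hi⟩⟩
  · intro t ht
    have h := box_V V hV (sideS i₀ t) (fun i => (sideS_pos i₀ t ht i).le) j (by omega)
    have h2 : V j (boxS (sideS i₀ t))
        = (∑ S ∈ F, (∏ i ∈ S, (2 * sideS i₀ t i)) * mS S) / kappa (n - j) := by
      rw [eq_div_iff hk.ne', mul_comm]; exact h
    rw [h2, ← Finset.sum_filter_add_sum_filter_not F (fun S => i₀ ∈ S), div_mul_eq_mul_div,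
      ← add_div, add_comm, Finset.sum_mul]
    congr 2
    · refine Finset.sum_congr rfl fun S hS => ?_
      simp only [F, Finset.mem_filter, Finset.mem_univ, true_and] at hS
      congr 1
      rw [← hS.1, ← Finset.prod_const]
      refine Finset.prod_congr rfl fun i hi => ?_
      have : i ≠ i₀ := fun h => hS.2 (h ▸ hi)
      simp [sideS, this]
    · refine Finset.sum_congr rfl fun S hS => ?_
      simp only [F, Finset.mem_filter, Finset.mem_univ, true_and] at hS
      rw [Finset.prod_mul_distrib, Finset.prod_const, hS.1]
      have : ∏ i ∈ S, sideS i₀ t i = t := by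
        unfold sideS
        rw [Finset.prod_update_of_mem hS.2]; simp
      rw [this]; ring

/-- Counterexamples to the `L_p`-Brunn-Minkowski inequality for intrinsic volumes, for every
`n ≥ 3`, `j ∈ {2,…,n-1}`, `p ∈ [0,1)` and `λ ∈ (0,1)`. -/
theorem Lp_BM_intrinsic_counterexample (n j : ℕ) (hn : 3 ≤ n) (hj2 : 2 ≤ j) (hjn : j ≤ n - 1)
    (p lam : ℝ) (hp : p ∈ Set.Ico (0 : ℝ) 1) (hlam : lam ∈ Set.Ioo (0 : ℝ) 1)
    (V : ℕ → Set (Euc n) → ℝ) (hV : steiner n V) :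
    ∃ K L : Set (Euc n),
      IsCompact K ∧ Convex ℝ K ∧ (interior K).Nonempty ∧ (∀ x ∈ K, -x ∈ K) ∧
      IsCompact L ∧ Convex ℝ L ∧ (interior L).Nonempty ∧ (∀ x ∈ L, -x ∈ L) ∧
      V j (wulff (fun u => combP p lam (suppFn K u) (suppFn L u)))
        < V j K ^ (1 - lam) * V j L ^ lam ∧
      V j K ^ (1 - lam) * V j L ^ lam
        ≤ (if p = 0 then V j K ^ (1 - lam) * V j L ^ lam
           else ((1 - lam) * V j K ^ (p / j) + lam * V j L ^ (p / j)) ^ ((j : ℝ) / p)) := by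
  obtain ⟨A, B, hA, hB, hAB⟩ := V_affine (n := n) (j := j) (by omega) (by omega) ⟨0, by omega⟩ V hV
  set i₀ : Fin n := ⟨0, by omega⟩
  set M := combP p lam 1 2 with hMdef
  have hM : M < 1 + lam := (combP_lt p lam 1 hp hlam one_pos).2
  have hM0 : 0 ≤ M := combP_nonneg p lam 1 2 hlam (by norm_num) (by norm_num)
  set x := (1 + lam - M) / 4 with hx
  have hx0 : 0 < x := by rw [hx]; linarith
  set e := A / B * x with he
  have he0 : 0 < e := by positivity
  have hfin := final_ineq lam M x hlam hM0 hM hx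
  obtain ⟨hl0, hl1⟩ := hlam
  have hl1' : 0 < 1 - lam := by linarith
  have h1 := sideS_pos i₀ e he0
  have h2 := sideS_pos i₀ (2 * e) (by linarith)
  have hBe : B * e = A * x := by rw [he]; field_simp
  have hVK : V j (boxS (sideS i₀ e)) = A * (1 + x) := by rw [hAB e he0, hBe]; ring
  have hVL : V j (boxS (sideS i₀ (2 * e))) = A * (1 + 2 * x) := by
    rw [hAB _ (by linarith)]; linear_combination 2 * hBe
  refine ⟨boxS (sideS i₀ e), boxS (sideS i₀ (2 * e)), box_compact _, box_convex _,
    box_interior _ h1, box_symm _, box_compact _, box_convex _, box_interior _ h2, box_symm _,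
    ?_, ?_⟩
  · rw [wulff_box (by omega) p lam hp ⟨hl0, hl1⟩ _ _ h1 h2]
    have hs : (fun i => combP p lam (sideS i₀ e i) (sideS i₀ (2 * e) i)) = sideS i₀ (e * M) := by
      funext i
      by_cases h : i = i₀
      · rw [h]; simp only [sideS, Function.update_self]
        exact (combP_lt p lam e hp ⟨hl0, hl1⟩ he0).1
      · simp only [sideS, Function.update_of_ne h]
        exact combP_self p lam 1 one_pos
    have hMpos : 0 < M := by
      rw [hMdef]; unfold combP; split_ifs <;> positivity
    rw [hs, hAB _ (by positivity), hVK, hVL, Real.mul_rpow hA.le (by linarith),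
      Real.mul_rpow hA.le (by linarith)]
    have e1 : A ^ (1 - lam) * A ^ lam = A := by rw [← Real.rpow_add hA]; simp
    calc A + B * (e * M) = A * (1 + x * M) := by linear_combination M * hBe
      _ < A * ((1 + x) ^ (1 - lam) * (1 + 2 * x) ^ lam) := mul_lt_mul_of_pos_left hfin hA
      _ = (A ^ (1 - lam) * A ^ lam) * ((1 + x) ^ (1 - lam) * (1 + 2 * x) ^ lam) := by rw [e1]
      _ = _ := by ring
  · split_ifs with h
    · exact le_rfl
    · have hX : 0 < V j (boxS (sideS i₀ e)) := by rw [hVK]; positivity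
      have hY : 0 < V j (boxS (sideS i₀ (2 * e))) := by rw [hVL]; positivity
      generalize V j (boxS (sideS i₀ e)) = X at hX
      generalize V j (boxS (sideS i₀ (2 * e))) = Y at hY
      have hp0 : 0 < p := lt_of_le_of_ne hp.1 (Ne.symm h)
      have hj0 : (0 : ℝ) < j := by exact_mod_cast (by omega : 0 < j)
      have hg := Real.geom_mean_le_arith_mean2_weighted hl1'.le hl0.le
        (Real.rpow_nonneg hX.le (p / j)) (Real.rpow_nonneg hY.le (p / j)) (by ring)
      have hg2 := Real.rpow_le_rpow (by positivity) hg (by positivity : 0 ≤ (j : ℝ) / p)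
      refine le_trans (le_of_eq ?_) hg2
      rw [Real.mul_rpow (by positivity) (by positivity), ← Real.rpow_mul hX.le,
        ← Real.rpow_mul hX.le, ← Real.rpow_mul hY.le, ← Real.rpow_mul hY.le]
      congr 2 <;> field_simp


end
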